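/- For any feasible point of the finite-dimensional program—i.e., p1, p2 ∈ ℝ_+^n and Γ1, Γ2 ∈ ℝ_+^{n×n} with Σ_{l,m} Γ1[l,m]·c(z_l,z_m) ≤ r1, Σ_{l,m} Γ2[l,m]·c(z_l,z_m) ≤ r2, row sums of Γ1 equal to the weight vector (1/n1,…,1/n1,0,…,0) of μ0 on (z_1,…,z_n), row sums of Γ2 equal to the weight vector (0,…,0,1/n2,…,1/n2) of ν0, column sums of Γ1 equal to p1 and column sums of Γ2 equal to p2—the discrete measures μ = Σ_{l=1}^n p1^l δ_{z_l} and ν = Σ_{l=1}^n p2^l δ_{z_l} are probability measures satisfying W(μ,μ0) ≤ r1, W(ν,ν0) ≤ r2, and KL(ν‖μ) ≤ Σ_{l=1}^n p2^l·log(p2^l/p1^l) (with conventions 0·log(0/a)=0 and b·log(b/0)=+∞ for b>0). Consequently, the infimum of KL(ν‖μ) over the two Wasserstein balls is at most the optimal value of the finite-dimensional program. -/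

import Mathlib

open MeasureTheory Real ENNReal

noncomputable section

open Classical in

/-- Kullback–Leibler divergence `KL(ν‖μ) = ∫ log (dν/dμ) dν`, valued in `(-∞, +∞]` (as `EReal`):
it is the Bochner integral of the log-likelihood ratio when `ν ≪ μ` and this ratio is
`ν`-integrable, and `+∞` otherwise (for probability measures with `ν ≪ μ` the negative part of
`log (dν/dμ)` is always `ν`-integrable, so non-integrability means the integral is `+∞`). -/
def KLdiv {X : Type*} [MeasurableSpace X] (ν μ : Measure X) : EReal :=
  if ν ≪ μ ∧ Integrable (llr ν μ) ν then ((∫ a, llr ν μ a ∂ν : ℝ) : EReal) else ⊤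

/-- Order-1 Wasserstein distance with transport cost `c`: the infimum of `∫ c dΓ` over all
couplings `Γ` of `P` and `Q` (measures on `X × X` with first marginal `P` and second
marginal `Q`). -/
def wassDist {X : Type*} [MeasurableSpace X] (c : X → X → ℝ) (P Q : Measure X) : ℝ≥0∞ :=
  ⨅ (Γ : Measure (X × X)) (_ : Γ.map Prod.fst = P) (_ : Γ.map Prod.snd = Q),
    ∫⁻ p, ENNReal.ofReal (c p.1 p.2) ∂Γ

/-- Empirical measure `(1/n) ∑ᵢ δ_{x i}` of `n` points. -/
def empMeasure {X : Type*} [MeasurableSpace X] {n : ℕ} (x : Fin n → X) : Measure X :=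
  ((n : ℝ≥0∞)⁻¹) • ∑ i, Measure.dirac (x i)

/-- The set of values `KL(ν‖μ)` as `(μ, ν)` ranges over the pairs of probability measures in the
Wasserstein balls of radii `r1, r2` around the empirical measures of `x` and `y`. -/
def klBallValues {X : Type*} [MeasurableSpace X] [MetricSpace X] {n1 n2 : ℕ}
    (x : Fin n1 → X) (y : Fin n2 → X) (r1 r2 : ℝ) : Set EReal :=
  {e | ∃ μ ν : Measure X, IsProbabilityMeasure μ ∧ IsProbabilityMeasure ν ∧
    wassDist dist μ (empMeasure x) ≤ ENNReal.ofReal r1 ∧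
    wassDist dist ν (empMeasure y) ≤ ENNReal.ofReal r2 ∧ e = KLdiv ν μ}

/-- Feasibility for the finite-dimensional program: `p1, p2 ∈ ℝ₊ⁿ`, `Γ1, Γ2 ∈ ℝ₊^{n×n}`,
transport-cost constraints with radii `r1, r2`, row sums of `Γ1` (resp. `Γ2`) equal to the weight
vector `(1/n1,…,1/n1,0,…,0)` of `μ0` (resp. `(0,…,0,1/n2,…,1/n2)` of `ν0`) on
`z = (x_1,…,x_{n1},y_1,…,y_{n2})`, and column sums equal to `p1` (resp. `p2`). -/
def progFeasible {X : Type*} [MeasurableSpace X] [MetricSpace X] {n1 n2 : ℕ}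
    (x : Fin n1 → X) (y : Fin n2 → X) (r1 r2 : ℝ)
    (p1 p2 : Fin (n1 + n2) → ℝ) (Γ1 Γ2 : Fin (n1 + n2) → Fin (n1 + n2) → ℝ) : Prop :=
  (∀ l, 0 ≤ p1 l) ∧ (∀ l, 0 ≤ p2 l) ∧ (∀ l m, 0 ≤ Γ1 l m) ∧ (∀ l m, 0 ≤ Γ2 l m) ∧
  (∑ l, ∑ m, Γ1 l m * dist (Fin.append x y l) (Fin.append x y m)) ≤ r1 ∧
  (∑ l, ∑ m, Γ2 l m * dist (Fin.append x y l) (Fin.append x y m)) ≤ r2 ∧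
  (∀ l, (∑ m, Γ1 l m) = if (l : ℕ) < n1 then (n1 : ℝ)⁻¹ else 0) ∧
  (∀ l, (∑ m, Γ2 l m) = if (l : ℕ) < n1 then 0 else (n2 : ℝ)⁻¹) ∧
  (∀ m, (∑ l, Γ1 l m) = p1 m) ∧ (∀ m, (∑ l, Γ2 l m) = p2 m)

/-- Objective `∑ₗ p2ˡ log (p2ˡ / p1ˡ)` of the finite-dimensional program, valued in
`(-∞, +∞]`, with the conventions `0 · log (0/a) = 0` for `a ≥ 0` and
`b · log (b/0) = +∞` for `b > 0`. -/
def progObj {n : ℕ} (p1 p2 : Fin n → ℝ) : EReal :=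
  ∑ l, (if p2 l = 0 then (0 : EReal) else if p1 l = 0 then (⊤ : EReal)
        else (((p2 l) * Real.log (p2 l / p1 l) : ℝ) : EReal))

/-- The set of objective values of the finite-dimensional program over its feasible points. -/
def progValues {X : Type*} [MeasurableSpace X] [MetricSpace X] {n1 n2 : ℕ}
    (x : Fin n1 → X) (y : Fin n2 → X) (r1 r2 : ℝ) : Set EReal :=
  {e | ∃ (p1 p2 : Fin (n1 + n2) → ℝ) (Γ1 Γ2 : Fin (n1 + n2) → Fin (n1 + n2) → ℝ),
    progFeasible x y r1 r2 p1 p2 Γ1 Γ2 ∧ e = progObj p1 p2}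

/-- The discrete measure with mass `p l` at `z l`. -/
abbrev discreteMeasure {X ι : Type*} [MeasurableSpace X] [Fintype ι] (z : ι → X) (p : ι → ℝ) :
    Measure X :=
  ∑ l, ENNReal.ofReal (p l) • Measure.dirac (z l)

section DiscreteMeasure

variable {X Y ι κ : Type*} [MeasurableSpace X] [MeasurableSpace Y] [Fintype ι] [Fintype κ]

lemma isProbabilityMeasure_discreteMeasure (z : ι → X) {p : ι → ℝ} (hp : ∀ l, 0 ≤ p l)
    (hsum : ∑ l, p l = 1) : IsProbabilityMeasure (discreteMeasure z p) := by
  constructor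
  simp [discreteMeasure, ← ENNReal.ofReal_sum_of_nonneg fun l _ => hp l, hsum]

lemma map_discreteMeasure {f : X → Y} (hf : Measurable f) (z : ι → X) (p : ι → ℝ) :
    (discreteMeasure z p).map f = discreteMeasure (f ∘ z) p := by
  rw [discreteMeasure, ← Measure.mapₗ_apply_of_measurable hf, map_sum]
  simp [discreteMeasure, Measure.mapₗ_apply_of_measurable hf, Measure.map_dirac' hf]

lemma discreteMeasure_prod_fst (z : ι → X) {G : ι × κ → ℝ} (hG : ∀ q, 0 ≤ G q) :
    discreteMeasure (fun q => z q.1) G = discreteMeasure z fun l => ∑ m, G (l, m) := by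
  simp only [discreteMeasure, Fintype.sum_prod_type,
    ENNReal.ofReal_sum_of_nonneg fun m _ => hG (_, m), Finset.sum_smul]

lemma discreteMeasure_prod_snd (z : κ → X) {G : ι × κ → ℝ} (hG : ∀ q, 0 ≤ G q) :
    discreteMeasure (fun q => z q.2) G = discreteMeasure z fun m => ∑ l, G (l, m) := by
  simp only [discreteMeasure, Fintype.sum_prod_type_right,
    ENNReal.ofReal_sum_of_nonneg fun l _ => hG (l, _), Finset.sum_smul]

lemma discreteMeasure_absolutelyContinuous (z : ι → X) {p q : ι → ℝ} (hq : ∀ l, 0 ≤ q l)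
    (hqp : ∀ l, q l = 0 → p l ≤ 0) : discreteMeasure z p ≪ discreteMeasure z q := by
  intro s hs
  simp only [discreteMeasure, Measure.coe_finsetSum, Finset.sum_apply, Measure.smul_apply,
    smul_eq_mul, Finset.sum_eq_zero_iff, Finset.mem_univ, true_implies, mul_eq_zero,
    ENNReal.ofReal_eq_zero] at hs ⊢
  exact fun l => (hs l).imp_left fun h => hqp l (le_antisymm h (hq l))

variable [MeasurableSingletonClass X]

lemma integrable_discreteMeasure (z : ι → X) (p : ι → ℝ) (f : X → ℝ) :
    Integrable f (discreteMeasure z p) :=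
  integrable_finsetSum_measure.2 fun _ _ =>
    (integrable_dirac (by simp)).smul_measure ENNReal.ofReal_ne_top

lemma integral_discreteMeasure (z : ι → X) {p : ι → ℝ} (hp : ∀ l, 0 ≤ p l) (f : X → ℝ) :
    ∫ a, f a ∂discreteMeasure z p = ∑ l, p l * f (z l) := by
  rw [integral_finsetSum_measure fun _ _ =>
    (integrable_dirac (by simp)).smul_measure ENNReal.ofReal_ne_top]
  simp [integral_smul_measure, hp]

lemma lintegral_ofReal_discreteMeasure (z : ι → X) {p : ι → ℝ} (hp : ∀ l, 0 ≤ p l) {f : X → ℝ}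
    (hf : ∀ a, 0 ≤ f a) :
    ∫⁻ a, ENNReal.ofReal (f a) ∂discreteMeasure z p
      = ENNReal.ofReal (∑ l, p l * f (z l)) := by
  rw [ENNReal.ofReal_sum_of_nonneg fun l _ => mul_nonneg (hp l) (hf _)]
  simp [discreteMeasure, lintegral_finsetSum_measure, ENNReal.ofReal_mul, hp]

lemma of_ae_discreteMeasure {z : ι → X} {p : ι → ℝ} {P : X → Prop}
    (h : ∀ᵐ a ∂discreteMeasure z p, P a) {l : ι} (hl : 0 < p l) : P (z l) := by
  have h' := ae_finsetSum_measure_iff.1 h l (Finset.mem_univ l)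
  rw [Measure.ae_ennreal_smul_measure_iff (by simpa using hl)] at h'
  simpa using h'

/-- The log-sum inequality, with the Radon–Nikodym derivative as comparison density. -/
lemma integral_llr_discreteMeasure_le (z : ι → X) {p q : ι → ℝ} (hp : ∀ l, 0 ≤ p l)
    (hq : ∀ l, 0 ≤ q l) (hpsum : ∑ l, p l = 1) (hqp : ∀ l, q l = 0 → p l = 0) :
    ∫ a, llr (discreteMeasure z p) (discreteMeasure z q) a ∂discreteMeasure z p
      ≤ ∑ l, p l * Real.log (p l / q l) := by
  set ν := discreteMeasure z p with hν
  set μ := discreteMeasure z q with hμ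
  have : IsProbabilityMeasure ν := isProbabilityMeasure_discreteMeasure z hp hpsum
  have : IsFiniteMeasure μ := ⟨by simp [hμ, discreteMeasure]⟩
  have hac : ν ≪ μ := discreteMeasure_absolutelyContinuous z hq fun l h => (hqp l h).le
  set R : ι → ℝ := fun l => (ν.rnDeriv μ (z l)).toReal
  have hRsum : ∑ l, q l * R l = 1 := by
    rw [← integral_discreteMeasure z hq fun a => (ν.rnDeriv μ a).toReal,
      Measure.integral_toReal_rnDeriv hac]
    simp
  have hRae : ∀ᵐ a ∂ν, 0 < (ν.rnDeriv μ a).toReal := by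
    filter_upwards [Measure.rnDeriv_pos hac, hac.ae_le (Measure.rnDeriv_lt_top ν μ)]
      with a hpos hlt using ENNReal.toReal_pos hpos.ne' hlt.ne
  have hterm (l : ι) : p l * llr ν μ (z l) + (p l - q l * R l) ≤ p l * Real.log (p l / q l) := by
    have hRnn : 0 ≤ R l := ENNReal.toReal_nonneg
    rcases (hp l).eq_or_lt with h0 | hpos
    · simpa [← h0] using mul_nonneg (hq l) hRnn
    have hqpos : 0 < q l := (hq l).lt_of_ne' fun h => hpos.ne' (hqp l h)
    have hRpos : 0 < R l := of_ae_discreteMeasure hRae hpos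
    have hlog := Real.log_le_sub_one_of_pos (x := q l * R l / p l) (by positivity)
    rw [Real.log_div (by positivity) hpos.ne', Real.log_mul hqpos.ne' hRpos.ne'] at hlog
    rw [Real.log_div hpos.ne' hqpos.ne']
    have hmul := mul_le_mul_of_nonneg_left hlog hpos.le
    have hcancel : p l * (q l * R l / p l - 1) = q l * R l - p l := by field_simp
    change p l * Real.log (R l) + _ ≤ _
    linarith
  rw [integral_discreteMeasure z hp]
  have := Finset.sum_le_sum fun l (_ : l ∈ Finset.univ) => hterm l
  rw [Finset.sum_add_distrib, Finset.sum_sub_distrib, hpsum, hRsum] at this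
  linarith

end DiscreteMeasure

lemma EReal.coe_finset_sum_real {ι : Type*} (s : Finset ι) (f : ι → ℝ) :
    ((∑ l ∈ s, f l : ℝ) : EReal) = ∑ l ∈ s, (f l : EReal) :=
  map_sum (⟨⟨Real.toEReal, EReal.coe_zero⟩, EReal.coe_add⟩ : ℝ →+ EReal) f s

lemma EReal.sum_ne_bot {ι : Type*} (s : Finset ι) {f : ι → EReal} (hf : ∀ l, f l ≠ ⊥) :
    ∑ l ∈ s, f l ≠ ⊥ :=
  Finset.sum_induction f (· ≠ ⊥) (fun _ _ ha hb => by simp [EReal.add_eq_bot_iff, ha, hb])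
    (by simp) fun l _ => hf l

lemma progObj_eq_top {n : ℕ} {p1 p2 : Fin n → ℝ} {l : Fin n} (h1 : p1 l = 0) (h2 : p2 l ≠ 0) :
    progObj p1 p2 = ⊤ := by
  rw [progObj, ← Finset.add_sum_erase _ _ (Finset.mem_univ l), if_neg h2, if_pos h1]
  refine EReal.top_add_of_ne_bot (EReal.sum_ne_bot _ fun m => ?_)
  split_ifs <;> simp [-EReal.coe_mul]

lemma progObj_eq_coe {n : ℕ} {p1 p2 : Fin n → ℝ} (h : ∀ l, p1 l = 0 → p2 l = 0) :
    progObj p1 p2 = ((∑ l, p2 l * Real.log (p2 l / p1 l) : ℝ) : EReal) := by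
  rw [progObj, EReal.coe_finset_sum_real]
  refine Finset.sum_congr rfl fun l _ => ?_
  split_ifs with h2 h1
  · simp [h2]
  · exact absurd (h l h1) h2
  · rfl

lemma KLdiv_discreteMeasure_le_progObj {X : Type*} [MeasurableSpace X]
    [MeasurableSingletonClass X] {n : ℕ} (z : Fin n → X) {p1 p2 : Fin n → ℝ}
    (h1 : ∀ l, 0 ≤ p1 l) (h2 : ∀ l, 0 ≤ p2 l) (hsum : ∑ l, p2 l = 1) :
    KLdiv (discreteMeasure z p2) (discreteMeasure z p1) ≤ progObj p1 p2 := by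
  by_cases h : ∀ l, p1 l = 0 → p2 l = 0
  · rw [progObj_eq_coe h, KLdiv, if_pos ⟨discreteMeasure_absolutelyContinuous z h1
      fun l hl => (h l hl).le, integrable_discreteMeasure z p2 _⟩]
    exact EReal.coe_le_coe_iff.2 (integral_llr_discreteMeasure_le z h2 h1 hsum h)
  · push Not at h
    obtain ⟨l, hl1, hl2⟩ := h
    exact (progObj_eq_top hl1 hl2).symm ▸ le_top

/-- A nonnegative matrix with row sums `w` and column sums `p` is a coupling of the
corresponding discrete measures. -/
lemma wassDist_discreteMeasure_le {X : Type*} [MeasurableSpace X] [MetricSpace X]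
    [MeasurableSingletonClass X] {ι : Type*} [Fintype ι] (z : ι → X) {w p : ι → ℝ}
    {G : ι → ι → ℝ} {r : ℝ} (hG : ∀ l m, 0 ≤ G l m)
    (hcost : ∑ l, ∑ m, G l m * dist (z l) (z m) ≤ r)
    (hrow : ∀ l, ∑ m, G l m = w l) (hcol : ∀ m, ∑ l, G l m = p m) :
    wassDist dist (discreteMeasure z p) (discreteMeasure z w) ≤ ENNReal.ofReal r := by
  have hG' (q : ι × ι) : 0 ≤ (fun q : ι × ι => G q.1 q.2) q := hG q.1 q.2
  refine iInf_le_of_le (discreteMeasure (fun q : ι × ι => (z q.2, z q.1)) fun q => G q.1 q.2)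
    (iInf_le_of_le ?_ (iInf_le_of_le ?_ ?_))
  · rw [map_discreteMeasure measurable_fst]
    exact (discreteMeasure_prod_snd z hG').trans (by simp only [hcol])
  · rw [map_discreteMeasure measurable_snd]
    exact (discreteMeasure_prod_fst z hG').trans (by simp only [hrow])
  · rw [lintegral_ofReal_discreteMeasure _ hG' (f := fun a : X × X => dist a.1 a.2)
      fun _ => dist_nonneg]
    refine ENNReal.ofReal_le_ofReal (le_of_eq_of_le ?_ hcost)
    simp only [Fintype.sum_prod_type, dist_comm]

section Append

variable {X : Type*} [MeasurableSpace X] {n1 n2 : ℕ}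

lemma empMeasure_eq_discreteMeasure_left (hn1 : 0 < n1) (x : Fin n1 → X) (y : Fin n2 → X) :
    empMeasure x = discreteMeasure (Fin.append x y)
      fun l => if (l : ℕ) < n1 then (n1 : ℝ)⁻¹ else 0 := by
  have h : (0 : ℝ) < n1 := Nat.cast_pos.2 hn1
  simp [empMeasure, discreteMeasure, Fin.sum_univ_add, Finset.smul_sum,
    ENNReal.ofReal_inv_of_pos h]

lemma empMeasure_eq_discreteMeasure_right (hn2 : 0 < n2) (x : Fin n1 → X) (y : Fin n2 → X) :
    empMeasure y = discreteMeasure (Fin.append x y)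
      fun l => if (l : ℕ) < n1 then 0 else (n2 : ℝ)⁻¹ := by
  have h : (0 : ℝ) < n2 := Nat.cast_pos.2 hn2
  simp [empMeasure, discreteMeasure, Fin.sum_univ_add, Finset.smul_sum,
    ENNReal.ofReal_inv_of_pos h]

/-- Feasible points induce probability measures in the balls, with divergence at most the
objective. -/
lemma progFeasible.measures_in_balls [MetricSpace X] [MeasurableSingletonClass X]
    (hn1 : 0 < n1) (hn2 : 0 < n2) {x : Fin n1 → X} {y : Fin n2 → X} {r1 r2 : ℝ}
    {p1 p2 : Fin (n1 + n2) → ℝ} {Γ1 Γ2 : Fin (n1 + n2) → Fin (n1 + n2) → ℝ}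
    (hfeas : progFeasible x y r1 r2 p1 p2 Γ1 Γ2) :
    IsProbabilityMeasure (discreteMeasure (Fin.append x y) p1) ∧
    IsProbabilityMeasure (discreteMeasure (Fin.append x y) p2) ∧
    wassDist dist (discreteMeasure (Fin.append x y) p1) (empMeasure x) ≤ ENNReal.ofReal r1 ∧
    wassDist dist (discreteMeasure (Fin.append x y) p2) (empMeasure y) ≤ ENNReal.ofReal r2 ∧
    KLdiv (discreteMeasure (Fin.append x y) p2) (discreteMeasure (Fin.append x y) p1)
      ≤ progObj p1 p2 := by
  obtain ⟨hp1, hp2, hΓ1, hΓ2, hc1, hc2, hrow1, hrow2, hcol1, hcol2⟩ := hfeas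
  have hsum1 : ∑ m, p1 m = 1 := by
    simp_rw [← hcol1]
    rw [Finset.sum_comm]
    simp [hrow1, Fin.sum_univ_add, hn1.ne']
  have hsum2 : ∑ m, p2 m = 1 := by
    simp_rw [← hcol2]
    rw [Finset.sum_comm]
    simp [hrow2, Fin.sum_univ_add, hn2.ne']
  refine ⟨isProbabilityMeasure_discreteMeasure _ hp1 hsum1,
    isProbabilityMeasure_discreteMeasure _ hp2 hsum2, ?_, ?_,
    KLdiv_discreteMeasure_le_progObj _ hp1 hp2 hsum2⟩
  · rw [empMeasure_eq_discreteMeasure_left hn1 x y]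
    exact wassDist_discreteMeasure_le _ hΓ1 hc1 hrow1 hcol1
  · rw [empMeasure_eq_discreteMeasure_right hn2 x y]
    exact wassDist_discreteMeasure_le _ hΓ2 hc2 hrow2 hcol2

end Append

/-- **Feasible points give measures in the balls (weak direction of Theorem 1).**
For any feasible point `(p1, p2, Γ1, Γ2)` of the finite-dimensional program, the discrete measures
`μ = ∑ₗ p1ˡ δ_{z_l}` and `ν = ∑ₗ p2ˡ δ_{z_l}` are probability measures lying in the respective
Wasserstein balls, with `KL(ν‖μ)` at most the program objective; consequently the infimum of
`KL(ν‖μ)` over the two balls is at most the optimal value of the program. -/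
theorem feasible_gives_measures_in_balls
    {X : Type*} [MeasurableSpace X] [MetricSpace X] [PolishSpace X] [BorelSpace X]
    {n1 n2 : ℕ} (hn1 : 0 < n1) (hn2 : 0 < n2)
    (x : Fin n1 → X) (y : Fin n2 → X) {r1 r2 : ℝ} (hr1 : 0 ≤ r1) (hr2 : 0 ≤ r2)
    (p1 p2 : Fin (n1 + n2) → ℝ) (Γ1 Γ2 : Fin (n1 + n2) → Fin (n1 + n2) → ℝ)
    (hfeas : progFeasible x y r1 r2 p1 p2 Γ1 Γ2) :
    IsProbabilityMeasure (∑ l, ENNReal.ofReal (p1 l) • Measure.dirac (Fin.append x y l)) ∧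
    IsProbabilityMeasure (∑ l, ENNReal.ofReal (p2 l) • Measure.dirac (Fin.append x y l)) ∧
    wassDist dist (∑ l, ENNReal.ofReal (p1 l) • Measure.dirac (Fin.append x y l)) (empMeasure x)
      ≤ ENNReal.ofReal r1 ∧
    wassDist dist (∑ l, ENNReal.ofReal (p2 l) • Measure.dirac (Fin.append x y l)) (empMeasure y)
      ≤ ENNReal.ofReal r2 ∧
    KLdiv (∑ l, ENNReal.ofReal (p2 l) • Measure.dirac (Fin.append x y l))
        (∑ l, ENNReal.ofReal (p1 l) • Measure.dirac (Fin.append x y l)) ≤ progObj p1 p2 ∧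
    sInf (klBallValues x y r1 r2) ≤ sInf (progValues x y r1 r2) := by
  obtain ⟨hμ, hν, hW1, hW2, hKL⟩ := hfeas.measures_in_balls hn1 hn2
  refine ⟨hμ, hν, hW1, hW2, hKL, le_sInf ?_⟩
  rintro e ⟨q1, q2, G1, G2, hq, rfl⟩
  obtain ⟨hμ, hν, hW1, hW2, hKL⟩ := hq.measures_in_balls hn1 hn2
  exact sInf_le_of_le ⟨_, _, hμ, hν, hW1, hW2, rfl⟩ hKL
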